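/- Let 0 < λ < 2 and μ > 0 be constants and suppose there is a constant C such that UDP(n,p) ≤ C·(n^{λ}·p^{μ} + n) for all integers n, p ≥ 1. Then there is a constant C' such that DDP(n,p) ≤ C'·( n^{1/(2−λ)}·p^{(1+μ−λ)/(2−λ)} + n^{1/2}·p + n ) for all integers n, p ≥ 1. -/

import Mathlib

open Finset

/-- A walk in a directed edge set `F`, given as the list of visited vertices. -/
def IsWalkOn {V : Type} (F : Finset (V × V)) (s t : V) (l : List V) : Prop :=
  l.Chain' (fun a b => (a, b) ∈ F) ∧ l.head? = some s ∧ l.getLast? = some t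

def ReachableOn {V : Type} (F : Finset (V × V)) (s t : V) : Prop :=
  ∃ l, IsWalkOn F s t l

/-- A directed weighted graph: a finite set of directed edges together with weights. -/
structure WDigraph (V : Type) where
  Edge : Finset (V × V)
  w : V × V → ℝ

namespace WDigraph

variable {V : Type}

/-- Total weight of a walk (sum of weights of consecutive pairs). -/
def walkWeight (G : WDigraph V) (l : List V) : ℝ :=
  ((l.zip l.tail).map G.w).sum

/-- Distance from `s` to `t` using only edges of `F`, with weights of `G`. -/
noncomputable def distOn (G : WDigraph V) (F : Finset (V × V)) (s t : V) : ℝ :=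
  sInf {x | ∃ l, IsWalkOn F s t l ∧ G.walkWeight l = x}

def IsWalk (G : WDigraph V) (s t : V) (l : List V) : Prop :=
  IsWalkOn G.Edge s t l

def Reachable (G : WDigraph V) (s t : V) : Prop :=
  ReachableOn G.Edge s t

noncomputable def dist (G : WDigraph V) (s t : V) : ℝ :=
  G.distOn G.Edge s t

/-- All edge weights equal to `1`. -/
def Unweighted (G : WDigraph V) : Prop := ∀ e ∈ G.Edge, G.w e = 1

/-- All edge weights positive. -/
def PosWeights (G : WDigraph V) : Prop := ∀ e ∈ G.Edge, 0 < G.w e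

/-- `F` is (the edge set of) an exact distance preserver of `(G, P)`. -/
def IsExactPreserver (G : WDigraph V) (F : Finset (V × V)) (P : Finset (V × V)) : Prop :=
  F ⊆ G.Edge ∧ ∀ q ∈ P, ReachableOn F q.1 q.2 ∧ G.distOn F q.1 q.2 = G.dist q.1 q.2

/-- Total (in plus out) degree of a vertex. -/
def degree [DecidableEq V] (G : WDigraph V) (v : V) : ℕ :=
  (G.Edge.filter fun e => e.1 = v ∨ e.2 = v).card

end WDigraph
/-- An undirected weighted graph: a finite set of undirected edges together with weights. -/
structure WGraph (V : Type) where
  Edge : Finset (Sym2 V)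
  w : Sym2 V → ℝ

namespace WGraph

variable {V : Type}

def walkWeight (G : WGraph V) (l : List V) : ℝ :=
  ((l.zip l.tail).map fun p => G.w s(p.1, p.2)).sum

def IsWalkOn (F : Finset (Sym2 V)) (s t : V) (l : List V) : Prop :=
  l.Chain' (fun a b => s(a, b) ∈ F) ∧ l.head? = some s ∧ l.getLast? = some t

noncomputable def distOn (G : WGraph V) (F : Finset (Sym2 V)) (s t : V) : ℝ :=
  sInf {x | ∃ l, IsWalkOn F s t l ∧ G.walkWeight l = x}

def IsWalk (G : WGraph V) (s t : V) (l : List V) : Prop := IsWalkOn G.Edge s t l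

def Reachable (G : WGraph V) (s t : V) : Prop := ∃ l, G.IsWalk s t l

noncomputable def dist (G : WGraph V) (s t : V) : ℝ := G.distOn G.Edge s t

def PosWeights (G : WGraph V) : Prop := ∀ e ∈ G.Edge, 0 < G.w e

def Unweighted (G : WGraph V) : Prop := ∀ e ∈ G.Edge, G.w e = 1

def IsExactPreserver (G : WGraph V) (F : Finset (Sym2 V)) (P : Finset (V × V)) : Prop :=
  F ⊆ G.Edge ∧ ∀ q ∈ P, (∃ l, IsWalkOn F q.1 q.2 l) ∧ G.distOn F q.1 q.2 = G.dist q.1 q.2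

end WGraph
/-- Minimum number of edges of an exact distance preserver of a directed graph. -/
noncomputable def minPresD (n : ℕ) (G : WDigraph (Fin n)) (P : Finset (Fin n × Fin n)) : ℕ :=
  sInf {k | ∃ F : Finset (Fin n × Fin n), G.IsExactPreserver F P ∧ F.card = k}

/-- Minimum number of edges of an exact distance preserver of an undirected graph. -/
noncomputable def minPresU (n : ℕ) (G : WGraph (Fin n)) (P : Finset (Fin n × Fin n)) : ℕ :=
  sInf {k | ∃ F : Finset (Sym2 (Fin n)), G.IsExactPreserver F P ∧ F.card = k}

/-- `DDP n p`: extremal size of directed distance preservers on `n` vertices, `p` demand pairs. -/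
noncomputable def DDP (n p : ℕ) : ℕ :=
  sSup {k | ∃ G : WDigraph (Fin n), G.PosWeights ∧
    ∃ P : Finset (Fin n × Fin n), P.card = p ∧ (∀ q ∈ P, G.Reachable q.1 q.2) ∧
      minPresD n G P = k}

/-- `DADP n p`: extremal size of DAG distance preservers on `n` vertices, `p` demand pairs. -/
noncomputable def DADP (n p : ℕ) : ℕ :=
  sSup {k | ∃ G : WDigraph (Fin n), G.PosWeights ∧
    (∃ f : Fin n → ℕ, ∀ e ∈ G.Edge, f e.1 < f e.2) ∧
    ∃ P : Finset (Fin n × Fin n), P.card = p ∧ (∀ q ∈ P, G.Reachable q.1 q.2) ∧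
      minPresD n G P = k}

/-- `UDP n p`: extremal size of undirected distance preservers on `n` vertices, `p` demand pairs. -/
noncomputable def UDP (n p : ℕ) : ℕ :=
  sSup {k | ∃ G : WGraph (Fin n), G.PosWeights ∧
    ∃ P : Finset (Fin n × Fin n), P.card = p ∧ (∀ q ∈ P, G.Reachable q.1 q.2) ∧
      minPresU n G P = k}

section Walks

variable {V : Type}

lemma IsWalkOn.refl (F : Finset (V × V)) (t : V) : IsWalkOn F t t [t] := by
  simp [IsWalkOn, List.Chain']

lemma IsWalkOn.cons {F : Finset (V × V)} {a b t : V} {l : List V} (hab : (a, b) ∈ F)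
    (hl : IsWalkOn F b t l) : IsWalkOn F a t (a :: l) := by
  obtain ⟨h1, h2, h3⟩ := hl
  match l, h1, h2, h3 with
  | c :: l, h1, h2, h3 =>
    obtain rfl : c = b := by simpa using h2
    exact ⟨by simpa [List.Chain', List.isChain_cons_cons, hab] using h1, by simp,
      by simpa using h3⟩

@[elab_as_elim]
lemma IsWalkOn.induct {F : Finset (V × V)} {t : V} {motive : ∀ s l, IsWalkOn F s t l → Prop}
    (nil : motive t [t] (.refl F t))
    (cons : ∀ a b l (hab : (a, b) ∈ F) (hl : IsWalkOn F b t (b :: l)), motive b (b :: l) hl →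
      motive a (a :: b :: l) (hl.cons hab))
    {s : V} {l : List V} (hl : IsWalkOn F s t l) : motive s l hl := by
  induction l generalizing s with
  | nil => simp [IsWalkOn] at hl
  | cons a l ih =>
    obtain ⟨h1, h2, h3⟩ := hl
    obtain rfl : a = s := by simpa using h2
    cases l with
    | nil =>
      obtain rfl : a = t := by simpa using h3
      exact nil
    | cons b l =>
      have h1' : (a, b) ∈ F ∧ List.Chain' (fun a b => (a, b) ∈ F) (b :: l) := by
        simpa [List.Chain', List.isChain_cons_cons] using h1
      have hw : IsWalkOn F b t (b :: l) := ⟨h1'.2, by simp, by simpa using h3⟩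
      exact cons a b l h1'.1 hw (ih hw)

lemma IsWalkOn.mono {F F' : Finset (V × V)} (h : F ⊆ F') {s t : V} {l : List V}
    (hl : IsWalkOn F s t l) : IsWalkOn F' s t l := by
  induction hl using IsWalkOn.induct with
  | nil => exact .refl _ _
  | cons a b l hab _ ih => exact ih.cons (h hab)

namespace WDigraph

variable (G : WDigraph V)

lemma walkWeight_singleton (a : V) : G.walkWeight [a] = 0 := by simp [walkWeight]

lemma walkWeight_cons_cons (a b : V) (l : List V) :
    G.walkWeight (a :: b :: l) = G.w (a, b) + G.walkWeight (b :: l) := by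
  simp [walkWeight]

lemma length_le_of_isWalkOn {F : Finset (V × V)} {c : ℝ} (hc : ∀ e ∈ F, c ≤ G.w e) {s t : V}
    {l : List V} (hl : IsWalkOn F s t l) : c * l.length ≤ G.walkWeight l + c := by
  induction hl using IsWalkOn.induct with
  | nil => simp [walkWeight_singleton]
  | cons a b l hab _ ih =>
    rw [walkWeight_cons_cons, List.length_cons]
    push_cast
    linarith [hc _ hab]

lemma walkWeight_nonneg {F : Finset (V × V)} (hF : ∀ e ∈ F, 0 < G.w e) {s t : V} {l : List V}
    (hl : IsWalkOn F s t l) : 0 ≤ G.walkWeight l := by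
  simpa using G.length_le_of_isWalkOn (c := 0) (fun e he => (hF e he).le) hl

lemma exists_walk_append {F : Finset (V × V)} {s x t : V} {l l' : List V}
    (hl : IsWalkOn F s x l) (hl' : IsWalkOn F x t l') :
    ∃ k, IsWalkOn F s t k ∧ G.walkWeight k = G.walkWeight l + G.walkWeight l' := by
  induction hl using IsWalkOn.induct with
  | nil => exact ⟨l', hl', by simp [walkWeight_singleton]⟩
  | cons a b l hab _ ih =>
    obtain ⟨k, hk, hkw⟩ := ih
    refine ⟨a :: k, hk.cons hab, ?_⟩
    match k, hk, hkw with
    | [], hk, _ => simp [IsWalkOn] at hk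
    | c :: k, hk, hkw =>
      obtain rfl : c = b := by simpa using hk.2.1
      rw [walkWeight_cons_cons, walkWeight_cons_cons, hkw, add_assoc]

lemma walkWeight_cons {F : Finset (V × V)} {a b t : V} {l : List V} (hl : IsWalkOn F b t l) :
    G.walkWeight (a :: l) = G.w (a, b) + G.walkWeight l := by
  match l, hl with
  | [], hl => simp [IsWalkOn] at hl
  | c :: l, hl =>
    obtain rfl : c = b := by simpa using hl.2.1
    rw [walkWeight_cons_cons]

lemma distOn_le {F : Finset (V × V)} (hF : ∀ e ∈ F, 0 < G.w e) {s t : V} {l : List V}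
    (hl : IsWalkOn F s t l) : G.distOn F s t ≤ G.walkWeight l := by
  refine csInf_le ⟨0, ?_⟩ ⟨l, hl, rfl⟩
  rintro _ ⟨l, hl, rfl⟩
  exact G.walkWeight_nonneg hF hl

lemma exists_walk_eq_distOn [Finite V] {F : Finset (V × V)} (hF : ∀ e ∈ F, 0 < G.w e) {s t : V}
    (h : ReachableOn F s t) : ∃ l, IsWalkOn F s t l ∧ G.walkWeight l = G.distOn F s t := by
  obtain ⟨l₀, hl₀⟩ := h
  obtain ⟨c, hc0, hc⟩ : ∃ c : ℝ, 0 < c ∧ ∀ e ∈ F, c ≤ G.w e := by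
    rcases F.eq_empty_or_nonempty with rfl | hne
    · exact ⟨1, one_pos, by simp⟩
    · obtain ⟨e, he, hmin⟩ := F.exists_min_image G.w hne
      exact ⟨G.w e, hF e he, hmin⟩
  let S : Set (List V) := {l | IsWalkOn F s t l ∧ G.walkWeight l ≤ G.walkWeight l₀}
  have hS : S.Finite := by
    refine (List.finite_length_le V ⌊(G.walkWeight l₀ + c) / c⌋₊).subset ?_
    rintro l ⟨hl, hle⟩
    have := G.length_le_of_isWalkOn hc hl
    refine Nat.le_floor ?_
    rw [le_div_iff₀ hc0]
    linarith
  obtain ⟨l, hl, hmin⟩ := hS.exists_minimalFor G.walkWeight S ⟨l₀, hl₀, le_rfl⟩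
  refine ⟨l, hl.1, le_antisymm (le_csInf ⟨_, l, hl.1, rfl⟩ ?_) (G.distOn_le hF hl.1)⟩
  rintro _ ⟨k, hk, rfl⟩
  by_contra! hlt
  exact absurd (hmin (j := k) ⟨hk, hlt.le.trans hl.2⟩ hlt.le) (not_le.2 hlt)

variable {G}

lemma Reachable.refl (x : V) : G.Reachable x x := ⟨_, .refl _ _⟩

lemma Reachable.trans {x y z : V} (h : G.Reachable x y) (h' : G.Reachable y z) :
    G.Reachable x z := by
  obtain ⟨l, hl⟩ := h
  obtain ⟨l', hl'⟩ := h'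
  obtain ⟨k, hk, -⟩ := G.exists_walk_append hl hl'
  exact ⟨k, hk⟩

lemma Reachable.step {x y : V} (h : (x, y) ∈ G.Edge) : G.Reachable x y :=
  ⟨_, (IsWalkOn.refl _ y).cons h⟩

lemma dist_nonneg (hG : G.PosWeights) (x y : V) : 0 ≤ G.dist x y := by
  refine Real.sInf_nonneg ?_
  rintro _ ⟨l, hl, rfl⟩
  exact G.walkWeight_nonneg hG hl

lemma dist_self (hG : G.PosWeights) (x : V) : G.dist x x = 0 :=
  le_antisymm ((G.distOn_le hG (.refl _ x)).trans_eq (G.walkWeight_singleton x))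
    (dist_nonneg hG x x)

lemma dist_le_weight {x y : V} (hG : G.PosWeights) (h : (x, y) ∈ G.Edge) :
    G.dist x y ≤ G.w (x, y) := by
  refine (G.distOn_le hG ((IsWalkOn.refl _ y).cons h)).trans_eq ?_
  rw [walkWeight_cons_cons, walkWeight_singleton, add_zero]

/-- `u` is the successor of `x` on some shortest path from `x` to `t`. -/
def IsNext (G : WDigraph V) (x u t : V) : Prop :=
  (x, u) ∈ G.Edge ∧ G.Reachable u t ∧ G.w (x, u) + G.dist u t = G.dist x t

lemma IsNext.dist_lt (hG : G.PosWeights) {x u t : V} (h : G.IsNext x u t) :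
    G.dist u t < G.dist x t := by
  linarith [hG _ h.1, h.2.2]

variable [Finite V]

lemma exists_walk_eq_dist (hG : G.PosWeights) {s t : V} (h : G.Reachable s t) :
    ∃ l, G.IsWalk s t l ∧ G.walkWeight l = G.dist s t :=
  G.exists_walk_eq_distOn hG h

lemma dist_triangle (hG : G.PosWeights) {x y z : V} (h : G.Reachable x y)
    (h' : G.Reachable y z) : G.dist x z ≤ G.dist x y + G.dist y z := by
  obtain ⟨l, hl, hlw⟩ := exists_walk_eq_dist hG h
  obtain ⟨l', hl', hlw'⟩ := exists_walk_eq_dist hG h'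
  obtain ⟨k, hk, hkw⟩ := G.exists_walk_append hl hl'
  rw [← hlw, ← hlw', ← hkw]
  exact G.distOn_le hG hk

lemma isNext_of_walk (hG : G.PosWeights) {a b t : V} {l : List V} (hab : (a, b) ∈ G.Edge)
    (hl : G.IsWalk b t l) (h : G.w (a, b) + G.walkWeight l = G.dist a t) :
    G.IsNext a b t ∧ G.walkWeight l = G.dist b t := by
  have hr : G.Reachable b t := ⟨l, hl⟩
  have h1 : G.dist b t ≤ G.walkWeight l := G.distOn_le hG hl
  have h2 := dist_triangle hG (.step hab) hr
  have h3 := dist_le_weight hG hab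
  exact ⟨⟨hab, hr, by linarith⟩, by linarith⟩

lemma exists_isNext (hG : G.PosWeights) {x t : V} (hxt : x ≠ t) (h : G.Reachable x t) :
    ∃ u, G.IsNext x u t := by
  obtain ⟨l, hl, hlw⟩ := exists_walk_eq_dist hG h
  revert hlw hxt
  induction hl using IsWalkOn.induct with
  | nil => exact fun h => absurd rfl h
  | cons a b l hab hl _ =>
    intro _ hlw
    rw [walkWeight_cons_cons] at hlw
    exact ⟨b, (isNext_of_walk hG hab hl hlw).1⟩

lemma dist_pos (hG : G.PosWeights) {x t : V} (hxt : x ≠ t) (h : G.Reachable x t) :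
    0 < G.dist x t := by
  obtain ⟨u, hu⟩ := exists_isNext hG hxt h
  linarith [hG _ hu.1, hu.2.2, dist_nonneg hG u t]

lemma edges_of_shortest (hG : G.PosWeights) {s t : V} {l : List V} (hl : G.IsWalk s t l)
    (hlw : G.walkWeight l = G.dist s t) :
    (l.zip l.tail).Nodup ∧
      ∀ e ∈ l.zip l.tail, e ∈ G.Edge ∧ G.dist e.1 t ≤ G.dist s t := by
  revert hlw
  induction hl using IsWalkOn.induct with
  | nil => simp
  | cons a b l hab hl ih =>
    intro hlw
    rw [walkWeight_cons_cons] at hlw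
    obtain ⟨hn, hlw⟩ := isNext_of_walk hG hab hl hlw
    obtain ⟨ih1, ih2⟩ := ih hlw
    have hlt := hn.dist_lt hG
    have heq : (a :: b :: l).zip (a :: b :: l).tail = (a, b) :: (b :: l).zip (b :: l).tail := by
      simp
    rw [heq]
    refine ⟨List.nodup_cons.2 ⟨fun hmem => ?_, ih1⟩, ?_⟩
    · exact absurd (ih2 _ hmem).2 (not_le.2 hlt)
    · intro e he
      rcases List.mem_cons.1 he with rfl | he
      · exact ⟨hab, le_rfl⟩
      · exact ⟨(ih2 e he).1, (ih2 e he).2.trans hlt.le⟩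

end WDigraph

lemma exists_generic_weights [Fintype V] [Encodable V] (E : Finset (V × V)) (w : V × V → ℝ) :
    ∃ w' : V × V → ℝ, ∀ S ⊆ E, ∀ T ⊆ E,
      (∑ e ∈ S, w e < ∑ e ∈ T, w e → ∑ e ∈ S, w' e < ∑ e ∈ T, w' e) ∧
      (S ≠ T → ∑ e ∈ S, w' e ≠ ∑ e ∈ T, w' e) := by
  let r : V × V → ℝ := fun e => (2 : ℝ) ^ Encodable.encode e
  have hr : ∀ S T : Finset (V × V), S ≠ T → ∑ e ∈ S, r e ≠ ∑ e ∈ T, r e := by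
    intro S T hST h
    let φ : (V × V) ↪ ℕ := ⟨Encodable.encode, Encodable.encode_injective⟩
    refine hST (Finset.map_injective φ (Finset.geomSum_injective (le_refl 2) ?_))
    have h' : ((∑ e ∈ S, 2 ^ Encodable.encode e : ℕ) : ℝ)
        = (∑ e ∈ T, 2 ^ Encodable.encode e : ℕ) := by
      push_cast
      exact h
    simpa [φ] using Nat.cast_injective h'
  have hev : ∀ᶠ ε in nhdsWithin (0 : ℝ) (Set.Ioi 0), ∀ S ∈ E.powerset, ∀ T ∈ E.powerset,
      (∑ e ∈ S, w e < ∑ e ∈ T, w e → ∑ e ∈ S, (w e + ε * r e) < ∑ e ∈ T, (w e + ε * r e)) ∧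
      (S ≠ T → ∑ e ∈ S, (w e + ε * r e) ≠ ∑ e ∈ T, (w e + ε * r e)) := by
    rw [Filter.eventually_all_finset]
    intro S _
    rw [Filter.eventually_all_finset]
    intro T _
    simp only [Finset.sum_add_distrib, ← Finset.mul_sum]
    set a := ∑ e ∈ S, w e
    set b := ∑ e ∈ T, w e
    set c := ∑ e ∈ S, r e with hc
    set d := ∑ e ∈ T, r e with hd
    refine Filter.Eventually.and ?_ ?_
    · by_cases hab : a < b
      · have h1 : Filter.Tendsto (fun ε : ℝ => a + ε * c) (nhdsWithin 0 (Set.Ioi 0)) (nhds a) :=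
          ((by fun_prop : Continuous fun ε : ℝ => a + ε * c).tendsto' 0 a
            (by simp)).mono_left nhdsWithin_le_nhds
        have h2 : Filter.Tendsto (fun ε : ℝ => b + ε * d) (nhdsWithin 0 (Set.Ioi 0)) (nhds b) :=
          ((by fun_prop : Continuous fun ε : ℝ => b + ε * d).tendsto' 0 b
            (by simp)).mono_left nhdsWithin_le_nhds
        filter_upwards [h1.eventually_lt h2 hab] with ε h _ using h
      · exact Filter.Eventually.of_forall fun _ h => absurd h hab
    · by_cases hST : S = T
      · exact Filter.Eventually.of_forall fun _ h => absurd hST h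
      have hcd : c - d ≠ 0 := sub_ne_zero.2 (hr S T hST)
      by_cases hab : a = b
      · filter_upwards [self_mem_nhdsWithin] with ε hε _ h
        have hε : 0 < ε := hε
        have : ε * (c - d) = 0 := by linarith
        exact (mul_ne_zero hε.ne' hcd) this
      · have h0 : (0 : ℝ) ≠ (b - a) / (c - d) :=
          (div_ne_zero (sub_ne_zero.2 (Ne.symm hab)) hcd).symm
        filter_upwards [nhdsWithin_le_nhds (isOpen_ne.mem_nhds h0)] with ε hε _ h
        refine hε ((eq_div_iff hcd).2 ?_)
        linarith
  obtain ⟨ε, hε⟩ := hev.exists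
  exact ⟨fun e => w e + ε * r e, fun S hS T hT =>
    hε S (Finset.mem_powerset.2 hS) T (Finset.mem_powerset.2 hT)⟩

namespace WDigraph

/-- Shortest paths are unique: every vertex has at most one successor towards each target. -/
def UniqueNext (G : WDigraph V) : Prop :=
  ∀ ⦃x u u' t : V⦄, G.IsNext x u t → G.IsNext x u' t → u = u'

lemma exists_perturbation [Fintype V] [DecidableEq V] [Encodable V] {G : WDigraph V}
    (hG : G.PosWeights) :
    ∃ G' : WDigraph V, G'.Edge = G.Edge ∧ G'.PosWeights ∧ G'.UniqueNext ∧
      ∀ s t l, G'.IsWalk s t l → G'.walkWeight l = G'.dist s t → G.walkWeight l = G.dist s t := by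
  obtain ⟨w', hw'⟩ := exists_generic_weights G.Edge G.w
  let G' : WDigraph V := ⟨G.Edge, w'⟩
  have hG' : G'.PosWeights := by
    intro e he
    have := (hw' ∅ (by simp) {e} (by simpa using he)).1 (by simpa using hG e he)
    simpa using this
  have hsub : ∀ (H : WDigraph V), H.PosWeights → ∀ s t l, H.IsWalk s t l →
      H.walkWeight l = H.dist s t → (l.zip l.tail).toFinset ⊆ H.Edge ∧
        ∀ w : V × V → ℝ, (WDigraph.mk H.Edge w).walkWeight l =
          ∑ e ∈ (l.zip l.tail).toFinset, w e := by
    intro H hH s t l hl hlw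
    obtain ⟨h1, h2⟩ := edges_of_shortest hH hl hlw
    exact ⟨fun e he => (h2 e (List.mem_toFinset.1 he)).1,
      fun w => (List.sum_toFinset w h1).symm⟩
  refine ⟨G', rfl, hG', ?_, ?_⟩
  · have key : ∀ x u t, G'.IsNext x u t → ∃ S ⊆ G.Edge, ∑ e ∈ S, w' e = G'.dist x t ∧
        ∀ v, (x, v) ∈ S ↔ v = u := by
      intro x u t hu
      obtain ⟨l, hl, hlw⟩ := exists_walk_eq_dist hG' hu.2.1
      have hx : G'.walkWeight (x :: l) = G'.dist x t := by
        rw [G'.walkWeight_cons hl, hlw, hu.2.2]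
      obtain ⟨h1, h2⟩ := hsub G' hG' x t (x :: l) (hl.cons hu.1) hx
      refine ⟨_, h1, (h2 w').symm.trans hx, fun v => ?_⟩
      match l, hl, hlw with
      | [], hl, _ => simp [WDigraph.IsWalk, IsWalkOn] at hl
      | b :: l, hl, hlw =>
        obtain rfl : b = u := by simpa using hl.2.1
        have h3 := (edges_of_shortest hG' hl hlw).2
        have heq : (x :: b :: l).zip (x :: b :: l).tail
            = (x, b) :: (b :: l).zip (b :: l).tail := by simp
        rw [heq, List.mem_toFinset, List.mem_cons]
        refine ⟨?_, fun h => .inl (by rw [h])⟩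
        rintro (h | h)
        · exact (Prod.mk.inj h).2
        · exact absurd (h3 _ h).2 (not_le.2 (hu.dist_lt hG'))
    intro x u u' t hu hu'
    obtain ⟨S, hS, hSw, hSu⟩ := key x u t hu
    obtain ⟨T, hT, hTw, hTu⟩ := key x u' t hu'
    have hST : S = T := by
      by_contra hne
      exact (hw' S hS T hT).2 hne (hSw.trans hTw.symm)
    rw [← hTu, ← hST, hSu]
  · intro s t l hl hlw
    obtain ⟨k, hk, hkw⟩ := exists_walk_eq_dist hG ⟨l, hl⟩
    obtain ⟨h1, h2⟩ := hsub G' hG' s t l hl hlw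
    obtain ⟨h3, h4⟩ := hsub G hG s t k hk hkw
    refine le_antisymm ?_ (G.distOn_le hG hl)
    by_contra! hlt
    have h5 : G.walkWeight l = _ := h2 G.w
    have h6 : G.walkWeight k = _ := h4 G.w
    have h7 : G'.walkWeight l = _ := h2 w'
    have h8 : G'.walkWeight k = _ := h4 w'
    have := (hw' _ h3 _ h1).1 (by rw [← h5, ← h6, hkw]; exact hlt)
    rw [← h7, ← h8, hlw] at this
    exact absurd (G'.distOn_le hG' hk) (not_le.2 this)

end WDigraph

end Walks

section ShortestPaths

namespace WDigraph

variable {V : Type} {G : WDigraph V}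

open Classical in
/-- The successor of `x` on a shortest path to `t`, with junk value `x` if there is none. -/
noncomputable def nxt (G : WDigraph V) (x t : V) : V :=
  if h : ∃ u, G.IsNext x u t then h.choose else x

/-- `y` lies on a shortest path from `x` to `t`. -/
def Btw (G : WDigraph V) (x y t : V) : Prop :=
  G.Reachable x y ∧ G.Reachable y t ∧ G.dist x y + G.dist y t = G.dist x t

lemma IsNext.nxt_eq (hU : G.UniqueNext) {x u t : V} (h : G.IsNext x u t) : G.nxt x t = u := by
  have h' : ∃ u, G.IsNext x u t := ⟨u, h⟩
  rw [nxt, dif_pos h']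
  exact hU h'.choose_spec h

lemma Btw.left (hG : G.PosWeights) {x t : V} (h : G.Reachable x t) : G.Btw x x t :=
  ⟨.refl x, h, by rw [dist_self hG, zero_add]⟩

lemma Btw.right (hG : G.PosWeights) {x t : V} (h : G.Reachable x t) : G.Btw x t t :=
  ⟨h, .refl t, by rw [dist_self hG, add_zero]⟩

lemma Btw.reachable {x y t : V} (h : G.Btw x y t) : G.Reachable x t := h.1.trans h.2.1

variable [Finite V]

lemma isNext_nxt (hG : G.PosWeights) {x t : V} (hxt : x ≠ t) (h : G.Reachable x t) :
    G.IsNext x (G.nxt x t) t := by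
  have h' := exists_isNext hG hxt h
  rw [nxt, dif_pos h']
  exact h'.choose_spec

lemma eq_of_dist_nonpos (hG : G.PosWeights) {x y : V} (h : G.Reachable x y)
    (hd : G.dist x y ≤ 0) : x = y := by
  by_contra hne
  exact absurd (dist_pos hG hne h) (not_lt.2 hd)

namespace Btw

lemma trans_left (hG : G.PosWeights) {x y z t : V} (h : G.Btw x y t) (h' : G.Btw x z y) :
    G.Btw x z t ∧ G.Btw z y t := by
  have hzt := h'.2.1.trans h.2.1
  have h1 := dist_triangle hG h'.1 hzt
  have h2 := dist_triangle hG h'.2.1 h.2.1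
  have h3 := h.2.2
  have h4 := h'.2.2
  exact ⟨⟨h'.1, hzt, by linarith⟩, ⟨h'.2.1, h.2.1, by linarith⟩⟩

lemma trans_right (hG : G.PosWeights) {x y z t : V} (h : G.Btw x y t) (h' : G.Btw y z t) :
    G.Btw x y z ∧ G.Btw x z t := by
  have hxz := h.1.trans h'.1
  have h1 := dist_triangle hG hxz h'.2.1
  have h2 := dist_triangle hG h.1 h'.1
  have h3 := h.2.2
  have h4 := h'.2.2
  exact ⟨⟨h.1, h'.1, by linarith⟩, ⟨hxz, h'.2.1, by linarith⟩⟩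

lemma antisymm (hG : G.PosWeights) {x y t : V} (h : G.Btw x y t) (h' : G.Btw y x t) :
    x = y := by
  refine eq_of_dist_nonpos hG h.1 ?_
  linarith [h.2.2, h'.2.2, dist_nonneg hG y x]

lemma eq_of_loop (hG : G.PosWeights) {x y : V} (h : G.Btw x y x) : x = y :=
  h.antisymm hG (right hG h.2.1)

lemma isNext (hG : G.PosWeights) {x y t u : V} (h : G.Btw x y t) (hu : G.IsNext x u y) :
    G.IsNext x u t ∧ G.Btw u y t := by
  have hut := hu.2.1.trans h.2.1
  have h1 := dist_triangle hG hu.2.1 h.2.1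
  have h2 := dist_triangle hG (.step hu.1) hut
  have h3 := dist_le_weight hG hu.1
  have h4 := hu.2.2
  have h5 := h.2.2
  exact ⟨⟨hu.1, hut, by linarith⟩, ⟨hu.2.1, h.2.1, by linarith⟩⟩

lemma nxt_eq (hG : G.PosWeights) (hU : G.UniqueNext) {x y t : V} (h : G.Btw x y t)
    (hne : x ≠ y) : G.nxt x y = G.nxt x t :=
  ((h.isNext hG (isNext_nxt hG hne h.1)).1.nxt_eq hU).symm

lemma total (hG : G.PosWeights) (hU : G.UniqueNext) {s t x y : V} (hx : G.Btw s x t)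
    (hy : G.Btw s y t) : G.Btw x y t ∨ G.Btw y x t := by
  obtain ⟨l, hl, hlw⟩ := exists_walk_eq_dist hG hx.reachable
  revert x y hlw
  induction hl using IsWalkOn.induct with
  | nil =>
    intro x y hx hy _
    obtain rfl := hx.eq_of_loop hG
    exact .inl hy
  | cons a b l hab hl ih =>
    intro x y hx hy hlw
    rw [walkWeight_cons_cons] at hlw
    obtain ⟨hn, hlw⟩ := isNext_of_walk hG hab hl hlw
    have hstep : ∀ z, G.Btw a z t → a ≠ z → G.Btw b z t := by
      intro z hz hne
      obtain ⟨h1, h2⟩ := hz.isNext hG (isNext_nxt hG hne hz.1)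
      rwa [hU h1 hn] at h2
    by_cases hax : a = x
    · exact .inl (hax ▸ hy)
    by_cases hay : a = y
    · exact .inr (hay ▸ hx)
    exact ih (hstep x hx hax) (hstep y hy hay) hlw

end Btw

/-- The shortest paths from `x` to `y` and from `x` to `r` diverge immediately. -/
def Leaves (G : WDigraph V) (r x y : V) : Prop :=
  x ≠ y ∧ G.Reachable x y ∧ G.nxt x y ≠ G.nxt x r

lemma Leaves.extend (hG : G.PosWeights) (hU : G.UniqueNext) {r x y t : V}
    (h : G.Leaves r x y) (hb : G.Btw x y t) : G.Leaves r x t := by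
  refine ⟨?_, hb.reachable, by rw [← hb.nxt_eq hG hU h.1]; exact h.2.2⟩
  rintro rfl
  exact h.1 (hb.eq_of_loop hG)

lemma Leaves.restrict (hG : G.PosWeights) (hU : G.UniqueNext) {r x y t : V}
    (h : G.Leaves r x t) (hb : G.Btw x y t) (hne : x ≠ y) : G.Leaves r x y :=
  ⟨hne, hb.1, by rw [hb.nxt_eq hG hU hne]; exact h.2.2⟩

/-- `x` and `y` are consecutive elements of `A` at which a shortest path diverges from the
shortest paths towards `r`. -/
def Hop (G : WDigraph V) (r : V) (A : Set V) (x y : V) : Prop :=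
  x ∈ A ∧ y ∈ A ∧ G.Leaves r x y ∧ ∀ z ∈ A, G.Btw x z y → z ≠ x → z ≠ y → ¬ G.Leaves r z y

/-- All elements of `A` lie on a common shortest path ending in `r`. -/
def PathTo (G : WDigraph V) (r : V) (A : Set V) : Prop :=
  ∀ x ∈ A, ∀ y ∈ A, G.Btw x y r ∨ G.Btw y x r

lemma Hop.dist_lt (hG : G.PosWeights) (hU : G.UniqueNext) {r : V} {A : Set V}
    (hA : G.PathTo r A) {x y : V} (h : G.Hop r A x y) : G.dist x r < G.dist y r := by
  obtain ⟨hx, hy, hl, -⟩ := h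
  rcases hA x hx y hy with hb | hb
  · exact absurd (hb.nxt_eq hG hU hl.1) hl.2.2
  · linarith [hb.2.2, dist_pos hG hl.1.symm hb.1]

lemma exists_hop (hG : G.PosWeights) (hU : G.UniqueNext) {r t x z : V} {A : Set V} (hx : x ∈ A)
    (hxl : G.Leaves r x t) (hz : z ∈ A) (hzl : G.Leaves r z t) (hb : G.Btw x z t)
    (hne : z ≠ x) : ∃ y, G.Hop r A x y ∧ G.Leaves r y t ∧ G.Btw x y t := by
  let S : Set V := {y | y ∈ A ∧ G.Leaves r y t ∧ G.Btw x y t ∧ y ≠ x}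
  obtain ⟨y, ⟨hyA, hyl, hyb, hyx⟩, hmax⟩ :=
    (Set.toFinite S).exists_maximalFor (fun y => G.dist y t) S ⟨z, hz, hzl, hb, hne⟩
  refine ⟨y, ⟨hx, hyA, hxl.restrict hG hU hyb hyx.symm, ?_⟩, hyl, hyb⟩
  intro v hvA hvb hvx hvy hvl
  obtain ⟨h1, h2⟩ := hyb.trans_left hG hvb
  have h3 : G.dist y t < G.dist v t := by linarith [h2.2.2, dist_pos hG hvy h2.1]
  exact absurd (hmax (j := v) ⟨hvA, hvl.extend hG hU h2, h1, hvx⟩ h3.le) (not_le.2 h3)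

section HopWalks

variable {m : ℕ} {H : WDigraph (Fin m)} {i : Fin m → V} {r : V} {M K : ℝ}

/-- `H` is the bidirected graph of hops between the vertices `i j`, reweighted by a potential that
makes hops in the wrong direction cost at least `K` more than necessary. -/
structure IsHopGraph (G : WDigraph V) (r : V) (i : Fin m → V) (M K : ℝ)
    (H : WDigraph (Fin m)) : Prop where
  pathTo : G.PathTo r (Set.range i)
  edge : ∀ j k, (j, k) ∈ H.Edge ↔
    G.Hop r (Set.range i) (i j) (i k) ∨ G.Hop r (Set.range i) (i k) (i j)
  w_forward : ∀ j k, G.Hop r (Set.range i) (i j) (i k) →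
    H.w (j, k) = M * (G.dist (i k) r - G.dist (i j) r) + G.dist (i j) (i k)
  w_backward : ∀ j k, G.Hop r (Set.range i) (i k) (i j) →
    H.w (j, k) = M * (G.dist (i j) r - G.dist (i k) r) + G.dist (i k) (i j)
  dist_lt : ∀ x y, G.dist x y < K
  penalty : ∀ j k, G.dist (i j) r < G.dist (i k) r →
    K ≤ 2 * (M * (G.dist (i k) r - G.dist (i j) r))

lemma IsHopGraph.le_walkWeight (hG : G.PosWeights) (hU : G.UniqueNext)
    (hH : G.IsHopGraph r i M K H) {b c : Fin m} {l : List (Fin m)} (hl : H.IsWalk c b l) :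
    M * (G.dist (i b) r - G.dist (i c) r) + K ≤ H.walkWeight l ∨
      G.Reachable (i c) (i b) ∧
        M * (G.dist (i b) r - G.dist (i c) r) + G.dist (i c) (i b) ≤ H.walkWeight l := by
  induction hl using IsWalkOn.induct with
  | nil => exact .inr ⟨.refl _, by simp [dist_self hG, walkWeight_singleton]⟩
  | cons x c l hxc hl ih =>
    rw [walkWeight_cons_cons]
    have hK := (dist_nonneg hG (i c) (i b)).trans_lt (hH.dist_lt _ _)
    rcases (hH.edge _ _).1 hxc with h | h
    · have h0 := dist_nonneg hG (i x) (i c)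
      rw [hH.w_forward _ _ h]
      rcases ih with ih | ⟨hr, ih⟩
      · left
        linarith
      · right
        have := dist_triangle hG h.2.2.1.2.1 hr
        exact ⟨h.2.2.1.2.1.trans hr, by linarith⟩
    · have h0 := dist_nonneg hG (i c) (i x)
      have h1 := hH.penalty _ _ (h.dist_lt hG hU hH.pathTo)
      have h2 := dist_nonneg hG (i c) (i b)
      rw [hH.w_backward _ _ h]
      left
      rcases ih with ih | ⟨hr, ih⟩ <;> linarith

lemma IsHopGraph.hops_of_shortest (hG : G.PosWeights) (hU : G.UniqueNext)
    (hi : Function.Injective i) (hH : G.IsHopGraph r i M K H) {F : Finset (Fin m × Fin m)}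
    (hF : F ⊆ H.Edge) {x b : Fin m} {l : List (Fin m)} (hl : IsWalkOn F x b l)
    (hr : G.Reachable (i x) (i b))
    (hle : H.walkWeight l ≤ M * (G.dist (i b) r - G.dist (i x) r) + G.dist (i x) (i b)) :
    (x ≠ b → G.Leaves r (i x) (i b)) ∧
      ∀ v y, G.Btw (i x) (i v) (i b) → G.Leaves r (i v) (i b) →
        G.Hop r (Set.range i) (i v) (i y) → G.Btw (i v) (i y) (i b) →
        (y ≠ b → G.Leaves r (i y) (i b)) → (v, y) ∈ F := by
  revert hr hle
  induction hl using IsWalkOn.induct with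
  | nil =>
    intro _ _
    refine ⟨fun h => absurd rfl h, fun v y h1 h2 _ _ _ => ?_⟩
    exact absurd (h1.eq_of_loop hG).symm h2.1
  | cons x c l hxc hl ih =>
    intro hr hle
    rw [walkWeight_cons_cons] at hle
    have hK := hH.dist_lt (i x) (i b)
    have hK0 := (dist_nonneg hG (i x) (i b)).trans_lt hK
    have hlow := hH.le_walkWeight hG hU (hl.mono hF)
    have h0 := dist_nonneg hG (i c) (i b)
    rcases (hH.edge _ _).1 (hF hxc) with h | h
    swap
    · exfalso
      have h1 := hH.penalty _ _ (h.dist_lt hG hU hH.pathTo)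
      have h2 := dist_nonneg hG (i c) (i x)
      rw [hH.w_backward _ _ h] at hle
      rcases hlow with hlow | ⟨-, hlow⟩ <;> linarith
    rw [hH.w_forward _ _ h] at hle
    have h1 := dist_nonneg hG (i x) (i c)
    rcases hlow with hlow | ⟨hcb, hlow⟩
    · linarith
    have htri := dist_triangle hG h.2.2.1.2.1 hcb
    have hbtw : G.Btw (i x) (i c) (i b) := ⟨h.2.2.1.2.1, hcb, by linarith⟩
    obtain ⟨ih1, ih2⟩ := ih hcb (by linarith)
    refine ⟨fun _ => h.2.2.1.extend hG hU hbtw, ?_⟩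
    intro v y hv hvl hop hy hyl
    by_cases hvx : v = x
    · subst hvx
      by_cases hyc : y = c
      · rwa [hyc]
      exfalso
      rcases hy.total hG hU hbtw with hb | hb
      · have hyb : y ≠ b := by
          rintro rfl
          exact hyc (hi (hb.eq_of_loop hG))
        have h3 := (hy.trans_right hG hb).1
        exact h.2.2.2 (i y) ⟨y, rfl⟩ h3 hop.2.2.1.1.symm (hi.ne hyc)
          ((hyl hyb).restrict hG hU hb (hi.ne hyc))
      · have hcb' : c ≠ b := by
          rintro rfl
          exact hyc (hi (hb.eq_of_loop hG).symm)
        have h3 := (hbtw.trans_right hG hb).1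
        exact hop.2.2.2 (i c) ⟨c, rfl⟩ h3 h.2.2.1.1.symm (hi.ne (Ne.symm hyc))
          ((ih1 hcb').restrict hG hU hb (hi.ne (Ne.symm hyc)))
    · rcases hbtw.total hG hU hv with hb | hb
      · exact ih2 v y hb hvl hop hy hyl
      · by_cases hvc : v = c
        · subst hvc
          exact ih2 v y (Btw.left hG hb.reachable) hvl hop hy hyl
        exact absurd (hvl.restrict hG hU hb (hi.ne hvc))
          (h.2.2.2 (i v) ⟨v, rfl⟩ (hv.trans_right hG hb).1 (hi.ne hvx) (hi.ne hvc))

lemma IsHopGraph.exists_walk (hG : G.PosWeights) (hU : G.UniqueNext)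
    (hi : Function.Injective i) (hH : G.IsHopGraph r i M K H) {s t : V} {b : Fin m}
    (hb : G.Leaves r (i b) t)
    (hlast : ∀ z, G.Btw s (i z) t → G.Leaves r (i z) t → G.Btw (i z) (i b) t)
    (a : Fin m) (ha : G.Btw s (i a) t) (hal : G.Leaves r (i a) t) :
    ∃ l, H.IsWalk a b l ∧
      H.walkWeight l = M * (G.dist (i b) r - G.dist (i a) r) + G.dist (i a) (i b) := by
  have hwf : WellFounded fun j k : Fin m => G.dist (i j) t < G.dist (i k) t :=
    @Finite.wellFounded_of_trans_of_irrefl _ _ _ ⟨fun _ _ _ => lt_trans⟩ ⟨fun _ => lt_irrefl _⟩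
  induction a using hwf.induction with
  | _ a ih =>
    by_cases hab : a = b
    · subst hab
      exact ⟨_, .refl _ _, by simp [dist_self hG, walkWeight_singleton]⟩
    obtain ⟨_, hop, hyl, hyb⟩ := exists_hop hG hU (A := Set.range i) ⟨a, rfl⟩ hal ⟨b, rfl⟩ hb
      (hlast a ha hal) (hi.ne (Ne.symm hab))
    obtain ⟨y, rfl⟩ := hop.2.1
    have hsy := (ha.trans_right hG hyb).2
    obtain ⟨l, hl, hlw⟩ := ih y (by linarith [hyb.2.2, dist_pos hG hop.2.2.1.1 hyb.1]) hsy hyl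
    refine ⟨a :: l, IsWalkOn.cons ((hH.edge _ _).2 (.inl hop)) hl, ?_⟩
    rw [H.walkWeight_cons hl, hlw, hH.w_forward _ _ hop,
      ← (hyb.trans_right hG (hlast y hsy hyl)).1.2.2]
    ring

end HopWalks

end WDigraph

end ShortestPaths

section Bidirection

namespace WGraph

variable {V : Type} [Fintype V] [DecidableEq V]

/-- The ordered pairs underlying a set of undirected edges. -/
def bidirect (F : Finset (Sym2 V)) : Finset (V × V) :=
  univ.filter fun p => s(p.1, p.2) ∈ F

lemma mem_bidirect {F : Finset (Sym2 V)} {a b : V} : (a, b) ∈ bidirect F ↔ s(a, b) ∈ F := by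
  simp [bidirect]

/-- An undirected graph viewed as a directed graph with both orientations of each edge. -/
def toDigraph (U : WGraph V) : WDigraph V :=
  ⟨bidirect U.Edge, fun p => U.w s(p.1, p.2)⟩

lemma isWalkOn_iff {F : Finset (Sym2 V)} {s t : V} {l : List V} :
    IsWalkOn F s t l ↔ _root_.IsWalkOn (bidirect F) s t l := by
  simp only [IsWalkOn, _root_.IsWalkOn, mem_bidirect]

lemma distOn_eq (U : WGraph V) (F : Finset (Sym2 V)) (s t : V) :
    U.distOn F s t = U.toDigraph.distOn (bidirect F) s t := by
  simp only [distOn, WDigraph.distOn, isWalkOn_iff]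
  rfl

lemma exists_preserver_le_UDP {n : ℕ} {U : WGraph (Fin n)} (hU : U.PosWeights)
    {P : Finset (Fin n × Fin n)} (hP : ∀ q ∈ P, U.Reachable q.1 q.2) :
    ∃ F, U.IsExactPreserver F P ∧ F.card ≤ UDP n P.card := by
  have hmem : ∀ (U : WGraph (Fin n)) (P : Finset (Fin n × Fin n)),
      (∀ q ∈ P, U.Reachable q.1 q.2) →
      U.Edge.card ∈ {k | ∃ F : Finset (Sym2 (Fin n)), U.IsExactPreserver F P ∧ F.card = k} :=
    fun U P hP => ⟨U.Edge, ⟨subset_rfl, fun q hq => ⟨hP q hq, rfl⟩⟩, rfl⟩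
  obtain ⟨F, hF, hcard⟩ := Nat.sInf_mem ⟨_, hmem U P hP⟩
  refine ⟨F, hF, hcard.trans_le (le_csSup ⟨Fintype.card (Sym2 (Fin n)), ?_⟩
    ⟨U, hU, P, rfl, hP, rfl⟩)⟩
  rintro _ ⟨U, -, P, -, hP, rfl⟩
  exact (Nat.sInf_le (hmem U P hP)).trans (Finset.card_le_univ _)

end WGraph

end Bidirection

section DegreeBound

namespace WDigraph

variable {V : Type} {G : WDigraph V}

lemma exists_isHopGraph [Finite V] (hG : G.PosWeights) (hU : G.UniqueNext) {m : ℕ}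
    {i : Fin m → V} {r : V} (hA : G.PathTo r (Set.range i)) :
    ∃ (U : WGraph (Fin m)) (M K : ℝ), U.PosWeights ∧ G.IsHopGraph r i M K U.toDigraph := by
  classical
  obtain ⟨K, hK⟩ : ∃ K, ∀ x y, G.dist x y < K := by
    obtain ⟨K, hK⟩ := (Set.finite_range fun p : V × V => G.dist p.1 p.2).bddAbove
    exact ⟨K + 1, fun x y => (hK ⟨(x, y), rfl⟩).trans_lt (lt_add_one K)⟩
  obtain ⟨M, hM0, hM⟩ : ∃ M : ℝ, 0 ≤ M ∧ ∀ x y, G.dist x r < G.dist y r →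
      K ≤ 2 * (M * (G.dist y r - G.dist x r)) := by
    obtain ⟨M, hM⟩ := (Set.finite_range
      fun p : V × V => K / (2 * (G.dist p.2 r - G.dist p.1 r))).bddAbove
    refine ⟨max M 0, le_max_right _ _, fun x y hxy => ?_⟩
    have h1 : K / (2 * (G.dist y r - G.dist x r)) ≤ max M 0 :=
      (hM ⟨(x, y), rfl⟩).trans (le_max_left _ _)
    rw [div_le_iff₀ (by linarith)] at h1
    linarith
  let w : V → V → ℝ := fun x y => M * |G.dist x r - G.dist y r| +
    ((if G.dist x r < G.dist y r then G.dist x y else 0) +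
      (if G.dist y r < G.dist x r then G.dist y x else 0))
  have hw : ∀ x y, w x y = w y x := fun x y => by
    simp only [w]
    rw [abs_sub_comm, add_comm (ite _ _ _)]
  have hlt : ∀ x y, G.Hop r (Set.range i) x y → G.dist x r < G.dist y r :=
    fun x y h => h.dist_lt hG hU hA
  have hwf : ∀ x y, G.Hop r (Set.range i) x y →
      w x y = M * (G.dist y r - G.dist x r) + G.dist x y := by
    intro x y h
    have h1 := hlt x y h
    simp only [w, if_pos h1, if_neg h1.not_gt, add_zero]
    rw [abs_sub_comm, abs_of_pos (sub_pos.2 h1)]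
  have hpos : ∀ x y, G.Hop r (Set.range i) x y → 0 < w x y := by
    intro x y h
    rw [hwf x y h]
    have h1 := mul_nonneg hM0 (sub_pos.2 (hlt x y h)).le
    linarith [dist_pos hG h.2.2.1.1 h.2.2.1.2.1]
  let U : WGraph (Fin m) :=
    ⟨(univ.filter fun p : Fin m × Fin m => G.Hop r (Set.range i) (i p.1) (i p.2)).image
        fun p => s(p.1, p.2),
      Sym2.lift ⟨fun j k => w (i j) (i k), fun j k => hw _ _⟩⟩
  refine ⟨U, M, K, ?_, hA, ?_, fun j k h => hwf _ _ h, ?_, hK, fun j k => hM _ _⟩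
  · intro e he
    obtain ⟨⟨j, k⟩, hjk, rfl⟩ := Finset.mem_image.1 he
    exact hpos _ _ (Finset.mem_filter.1 hjk).2
  · intro j k
    simp only [WGraph.toDigraph, WGraph.mem_bidirect, U, Finset.mem_image, Finset.mem_filter,
      Finset.mem_univ, true_and, Sym2.eq_iff, Prod.exists]
    constructor
    · rintro ⟨a, b, h, ⟨rfl, rfl⟩ | ⟨rfl, rfl⟩⟩
      exacts [.inl h, .inr h]
    · rintro (h | h)
      exacts [⟨j, k, h, .inl ⟨rfl, rfl⟩⟩, ⟨k, j, h, .inr ⟨rfl, rfl⟩⟩]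
  · intro j k h
    exact (hw _ _).trans (hwf _ _ h)

lemma exists_first_last [Finite V] (hG : G.PosWeights) (hU : G.UniqueNext) {m : ℕ}
    (i : Fin m → V) (s t : V) (S : Set (Fin m)) (hS : ∀ z ∈ S, G.Btw s (i z) t)
    (hne : S.Nonempty) :
    ∃ a b, a ∈ S ∧ b ∈ S ∧ (∀ z ∈ S, G.Btw (i a) (i z) t) ∧ ∀ z ∈ S, G.Btw (i z) (i b) t := by
  have key : ∀ x y, G.Btw s x t → G.Btw s y t → G.dist y t ≤ G.dist x t → G.Btw x y t := by
    intro x y hx hy hle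
    rcases hx.total hG hU hy with h | h
    · exact h
    · obtain rfl : y = x := eq_of_dist_nonpos hG h.1 (by linarith [h.2.2])
      exact h
  obtain ⟨a, ha, hmax⟩ := (Set.toFinite S).exists_maximalFor (fun z => G.dist (i z) t) S hne
  obtain ⟨b, hb, hmin⟩ := (Set.toFinite S).exists_minimalFor (fun z => G.dist (i z) t) S hne
  refine ⟨a, b, ha, hb, fun z hz => key _ _ (hS a ha) (hS z hz) ?_,
    fun z hz => key _ _ (hS z hz) (hS b hb) ?_⟩
  · exact (le_total _ _).elim id fun h => hmax hz h
  · exact (le_total _ _).elim id fun h => hmin hz h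

variable [Fintype V]

open Classical in
/-- The edges of the shortest paths of the demand pairs. -/
noncomputable def pathEdges (G : WDigraph V) (P : Finset (V × V)) : Finset (V × V) :=
  univ.filter fun e => ∃ q ∈ P, G.Btw q.1 e.1 q.2 ∧ G.IsNext e.1 e.2 q.2

lemma mem_pathEdges {P : Finset (V × V)} {x u : V} :
    (x, u) ∈ G.pathEdges P ↔ ∃ q ∈ P, G.Btw q.1 x q.2 ∧ G.IsNext x u q.2 := by
  simp [pathEdges]

lemma exists_walk_pathEdges (hG : G.PosWeights) {P : Finset (V × V)} {q : V × V} (hq : q ∈ P)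
    (hr : G.Reachable q.1 q.2) :
    ∃ l, IsWalkOn (G.pathEdges P) q.1 q.2 l ∧ G.walkWeight l = G.dist q.1 q.2 := by
  obtain ⟨s, t⟩ := q
  have key : ∀ x l, G.IsWalk x t l → G.Btw s x t → G.walkWeight l = G.dist x t →
      IsWalkOn (G.pathEdges P) x t l := by
    intro x l hl
    induction hl using IsWalkOn.induct with
    | nil => exact fun _ _ => .refl _ _
    | cons a b l hab hl ih =>
      intro hb hlw
      rw [walkWeight_cons_cons] at hlw
      obtain ⟨hn, hlw⟩ := isNext_of_walk hG hab hl hlw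
      refine (ih ?_ hlw).cons (mem_pathEdges.2 ⟨_, hq, hb, hn⟩)
      have h1 := dist_le_weight hG hab
      have h2 := dist_triangle hG (.step hab) hn.2.1
      refine (hb.trans_right hG ⟨.step hab, hn.2.1, ?_⟩).2
      linarith [hn.2.2]
  obtain ⟨l, hl, hlw⟩ := exists_walk_eq_dist hG hr
  exact ⟨l, key s l hl (.left hG hr) hlw, hlw⟩

open Classical in
lemma card_pathEdges_filter_le (hG : G.PosWeights) (hU : G.UniqueNext) (P : Finset (V × V))
    {r : V} {A : Finset V} (hA : G.PathTo r A) {N : ℕ}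
    (hN : ∀ U : WGraph (Fin A.card), U.PosWeights → ∀ Q, Q.card ≤ P.card →
      (∀ q ∈ Q, U.Reachable q.1 q.2) → ∃ F, U.IsExactPreserver F Q ∧ F.card ≤ N) :
    ((G.pathEdges P).filter fun e => e.1 ∈ A).card ≤ A.card + P.card + N := by
  let i : Fin A.card → V := fun j => A.equivFin.symm j
  have hi : Function.Injective i := Subtype.val_injective.comp A.equivFin.symm.injective
  have hiA : Set.range i = A := by
    ext x
    refine ⟨?_, fun hx => ⟨A.equivFin ⟨x, hx⟩, by simp [i]⟩⟩
    rintro ⟨j, rfl⟩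
    exact (A.equivFin.symm j).2
  rw [← hiA] at hA
  obtain ⟨U, M, K, hUpos, hH⟩ := exists_isHopGraph hG hU hA
  let S : V × V → Set (Fin A.card) := fun q =>
    {z | G.Btw q.1 (i z) q.2 ∧ G.Leaves r (i z) q.2}
  have hfl : ∀ q : {q : V × V // (S q).Nonempty}, ∃ a b, a ∈ S q ∧ b ∈ S q ∧
      (∀ z ∈ S q, G.Btw (i a) (i z) q.1.2) ∧ ∀ z ∈ S q, G.Btw (i z) (i b) q.1.2 :=
    fun q => exists_first_last hG hU i q.1.1 q.1.2 (S q) (fun z hz => hz.1) q.2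
  choose a b ha hb hfirst hlast using hfl
  let P' : Finset {q : V × V // (S q).Nonempty} := P.subtype _
  have hP' : P'.card ≤ P.card := by
    rw [Finset.card_subtype]
    exact Finset.card_filter_le _ _
  have hwalk : ∀ q : {q : V × V // (S q).Nonempty}, ∃ l, U.toDigraph.IsWalk (a q) (b q) l ∧
      U.toDigraph.walkWeight l = M * (G.dist (i (b q)) r - G.dist (i (a q)) r) +
        G.dist (i (a q)) (i (b q)) := fun q =>
    hH.exists_walk hG hU hi (hb q).2 (fun z h1 h2 => hlast q z ⟨h1, h2⟩) (a q) (ha q).1 (ha q).2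
  obtain ⟨F, ⟨hFU, hF⟩, hFN⟩ := hN U hUpos (P'.image fun q => (a q, b q))
    (Finset.card_image_le.trans hP') (by
      intro q hq
      obtain ⟨q, -, rfl⟩ := Finset.mem_image.1 hq
      obtain ⟨l, hl, -⟩ := hwalk q
      exact ⟨l, WGraph.isWalkOn_iff.2 hl⟩)
  have hDpos : U.toDigraph.PosWeights := fun e he => hUpos _ (WGraph.mem_bidirect.1 he)
  have hFsub : WGraph.bidirect F ⊆ U.toDigraph.Edge := fun e he =>
    WGraph.mem_bidirect.2 (hFU (WGraph.mem_bidirect.1 he))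
  let T : Finset (Fin A.card × Fin A.card) :=
    univ.filter fun p => s(p.1, p.2) ∈ F ∧ G.Hop r (Set.range i) (i p.1) (i p.2)
  have hT : T.card ≤ N := by
    refine le_trans (Finset.card_le_card_of_injOn (fun p => s(p.1, p.2)) ?_ ?_) hFN
    · intro p hp
      exact (Finset.mem_filter.1 hp).2.1
    · rintro ⟨j, k⟩ hp ⟨j', k'⟩ hp' heq
      have h1 := (Finset.mem_filter.1 hp).2.2.dist_lt hG hU hA
      have h2 := (Finset.mem_filter.1 hp').2.2.dist_lt hG hU hA
      rcases Sym2.eq_iff.1 heq with ⟨rfl, rfl⟩ | ⟨rfl, rfl⟩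
      · rfl
      · exact absurd h1 h2.not_gt
  have hcover : (G.pathEdges P).filter (fun e => e.1 ∈ A) ⊆
      (A.image fun v => (v, G.nxt v r)) ∪
        (P'.image fun q => (i (b q), G.nxt (i (b q)) q.1.2)) ∪
        (T.image fun p => (i p.1, G.nxt (i p.1) (i p.2))) := by
    rintro ⟨x, u⟩ hxu
    obtain ⟨hxu, hxA⟩ := Finset.mem_filter.1 hxu
    obtain ⟨q, hq, hbtw, hnext⟩ := mem_pathEdges.1 hxu
    have hu := hnext.nxt_eq hU
    by_cases hur : G.nxt x r = u
    · exact Finset.mem_union_left _ (Finset.mem_union_left _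
        (Finset.mem_image.2 ⟨x, hxA, by rw [hur]⟩))
    obtain ⟨v, rfl⟩ : x ∈ Set.range i := hiA ▸ hxA
    have hvl : G.Leaves r (i v) q.2 := by
      refine ⟨?_, hbtw.2.1, by rw [hu]; exact Ne.symm hur⟩
      intro h
      have := hnext.dist_lt hG
      rw [h, dist_self hG] at this
      exact absurd (dist_nonneg hG u q.2) (not_le.2 this)
    have hvS : v ∈ S q := ⟨hbtw, hvl⟩
    let q' : {q : V × V // (S q).Nonempty} := ⟨q, v, hvS⟩
    have hq' : q' ∈ P' := Finset.mem_subtype.2 hq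
    by_cases hvb : v = b q'
    · refine Finset.mem_union_left _ (Finset.mem_union_right _
        (Finset.mem_image.2 ⟨q', hq', ?_⟩))
      rw [← hvb, ← hu]
    have hvb' := hlast q' v hvS
    obtain ⟨_, hop, hyl, hyb⟩ := exists_hop hG hU (A := Set.range i) ⟨v, rfl⟩ hvl
      ⟨b q', rfl⟩ (hb q').2 hvb' (hi.ne (Ne.symm hvb))
    obtain ⟨y, rfl⟩ := hop.2.1
    have hyS : y ∈ S q := ⟨(hbtw.trans_right hG hyb).2, hyl⟩
    have hyb' := hlast q' y hyS
    obtain ⟨⟨k₀, hk₀⟩, hdist⟩ := hF _ (Finset.mem_image_of_mem _ hq')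
    obtain ⟨l₀, hl₀, hlw₀⟩ := hwalk q'
    obtain ⟨k, hk, hkw⟩ := U.toDigraph.exists_walk_eq_distOn
      (fun e he => hDpos e (hFsub he)) ⟨k₀, WGraph.isWalkOn_iff.1 hk₀⟩
    have hkle : U.toDigraph.walkWeight k ≤ M * (G.dist (i (b q')) r - G.dist (i (a q')) r) +
        G.dist (i (a q')) (i (b q')) := by
      rw [hkw, ← hlw₀, ← WGraph.distOn_eq, hdist, WGraph.dist, WGraph.distOn_eq]
      exact U.toDigraph.distOn_le hDpos hl₀
    have hab := hfirst q' (b q') (hb q')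
    have hmem := (hH.hops_of_shortest hG hU hi hFsub hk hab.1 hkle).2 v y
      ((hfirst q' v hvS).trans_right hG hvb').1 (hvl.restrict hG hU hvb' (hi.ne hvb)) hop
      (hyb.trans_right hG hyb').1 (fun hne => hyl.restrict hG hU hyb' (hi.ne hne))
    refine Finset.mem_union_right _ (Finset.mem_image.2 ⟨(v, y),
      Finset.mem_filter.2 ⟨Finset.mem_univ _, WGraph.mem_bidirect.1 hmem, hop⟩, ?_⟩)
    rw [hyb.nxt_eq hG hU hop.2.2.1.1, hu]
  refine (Finset.card_le_card hcover).trans ((Finset.card_union_le _ _).trans (add_le_add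
    ((Finset.card_union_le _ _).trans (add_le_add Finset.card_image_le ?_)) ?_))
  · exact Finset.card_image_le.trans hP'
  · exact Finset.card_image_le.trans hT

end WDigraph

end DegreeBound

section Counting

lemma mul_sum_le_of_small {α : Type*} [DecidableEq α] (f : α → ℕ) (k B : ℕ) (S : Finset α)
    (h : ∀ T ⊆ S, T.card ≤ k → ∑ e ∈ T, f e ≤ B) : k * ∑ e ∈ S, f e ≤ B * (k + S.card) := by
  induction S using Finset.strongInduction with
  | H S ih =>
    by_cases hS : S.card ≤ k
    · nlinarith [h S subset_rfl hS]
    rcases Nat.eq_zero_or_pos k with rfl | hk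
    · simp
    obtain ⟨T, hTS, hTk⟩ := Finset.exists_subset_card_eq (not_le.1 hS).le
    have hT := h T hTS hTk.le
    have hne : T.Nonempty := Finset.card_pos.1 (hTk ▸ hk)
    have h1 := ih (S \ T) (Finset.sdiff_ssubset hTS hne)
      fun R hR => h R (hR.trans Finset.sdiff_subset)
    have h2 := Finset.card_sdiff_add_card_eq_card hTS
    rw [← Finset.sum_sdiff hTS, ← h2, hTk]
    nlinarith

lemma card_sq_le_mul_sum_outdegree {V : Type*} [Fintype V] [DecidableEq V]
    (F : Finset (V × V)) :
    F.card ^ 2 ≤ Fintype.card V * ∑ e ∈ F, (F.filter fun e' => e'.1 = e.1).card := by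
  have h1 : F.card = ∑ v : V, (F.filter fun e => e.1 = v).card :=
    Finset.card_eq_sum_card_fiberwise fun _ _ => Finset.mem_coe.2 (Finset.mem_univ _)
  have h2 : ∑ e ∈ F, (F.filter fun e' => e'.1 = e.1).card
      = ∑ v : V, (F.filter fun e => e.1 = v).card ^ 2 := by
    rw [← Finset.sum_fiberwise F Prod.fst]
    refine Finset.sum_congr rfl fun v _ => ?_
    rw [sq, ← smul_eq_mul, ← Finset.sum_const]
    refine Finset.sum_congr rfl fun e he => ?_
    rw [(Finset.mem_filter.1 he).2]
  rw [h2, h1]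
  exact sq_sum_le_card_mul_sum_sq

open Classical in
lemma WDigraph.mul_card_pathEdges_sq_le {V : Type} [Fintype V] {G : WDigraph V}
    (hG : G.PosWeights) (hU : G.UniqueNext) (P : Finset (V × V)) {k N : ℕ}
    (hN : ∀ m ≤ k, ∀ U : WGraph (Fin m), U.PosWeights → ∀ Q, Q.card ≤ P.card →
      (∀ q ∈ Q, U.Reachable q.1 q.2) → ∃ F, U.IsExactPreserver F Q ∧ F.card ≤ N) :
    k * (G.pathEdges P).card ^ 2 ≤
      Fintype.card V * ((k + P.card + N) * (k * P.card + (G.pathEdges P).card)) := by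
  set F := G.pathEdges P with hF
  have hown : ∀ e : V × V, ∃ q, e ∈ F → q ∈ P ∧ G.Btw q.1 e.1 q.2 ∧ G.IsNext e.1 e.2 q.2 := by
    intro e
    by_cases he : e ∈ F
    · obtain ⟨q, hq, h⟩ := mem_pathEdges.1 he
      exact ⟨q, fun _ => ⟨hq, h⟩⟩
    · exact ⟨e, fun h => absurd h he⟩
  choose own hown using hown
  have hsmall : ∀ q, k * ∑ e ∈ F.filter (fun e => own e = q),
      (F.filter fun e' => e'.1 = e.1).card ≤
        (k + P.card + N) * (k + (F.filter fun e => own e = q).card) := by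
    intro q
    refine mul_sum_le_of_small _ _ _ _ fun T hT hTk => ?_
    have hTq : ∀ e ∈ T, q ∈ P ∧ G.Btw q.1 e.1 q.2 ∧ G.IsNext e.1 e.2 q.2 := by
      intro e he
      obtain ⟨heF, rfl⟩ := Finset.mem_filter.1 (hT he)
      exact hown e heF
    have hinj : Set.InjOn Prod.fst (T : Set (V × V)) := by
      intro e he e' he' heq
      refine Prod.ext heq ?_
      rw [← (hTq e he).2.2.nxt_eq hU, ← (hTq e' he').2.2.nxt_eq hU, heq]
    have hsum : ∑ e ∈ T, (F.filter fun e' => e'.1 = e.1).card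
        = (F.filter fun e => e.1 ∈ T.image Prod.fst).card := by
      rw [← Finset.sum_image (f := fun v => (F.filter fun e' => e'.1 = v).card) hinj,
        Finset.card_eq_sum_card_fiberwise (f := Prod.fst) (t := T.image Prod.fst)
          fun e he => Finset.mem_coe.2 (Finset.mem_filter.1 (Finset.mem_coe.1 he)).2]
      refine Finset.sum_congr rfl fun v hv => ?_
      congr 1
      ext e
      simp only [Finset.mem_filter]
      exact ⟨fun h => ⟨⟨h.1, h.2 ▸ hv⟩, h.2⟩, fun h => ⟨h.1.1, h.2⟩⟩
    have hcard : (T.image Prod.fst).card ≤ k := Finset.card_image_le.trans hTk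
    have hpath : G.PathTo q.2 (T.image Prod.fst : Finset V) := by
      intro x hx y hy
      obtain ⟨e, he, rfl⟩ := Finset.mem_image.1 hx
      obtain ⟨e', he', rfl⟩ := Finset.mem_image.1 hy
      exact (hTq e he).2.1.total hG hU (hTq e' he').2.1
    rw [hsum]
    refine (card_pathEdges_filter_le hG hU P hpath (hN _ hcard)).trans ?_
    omega
  have hmaps : Set.MapsTo own F P := fun e he => (hown e he).1
  calc k * F.card ^ 2
      ≤ k * (Fintype.card V * ∑ e ∈ F, (F.filter fun e' => e'.1 = e.1).card) :=
        Nat.mul_le_mul_left _ (card_sq_le_mul_sum_outdegree F)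
    _ = Fintype.card V * ∑ q ∈ P, k * ∑ e ∈ F.filter (fun e => own e = q),
          (F.filter fun e' => e'.1 = e.1).card := by
        rw [← Finset.mul_sum, Finset.sum_fiberwise_of_maps_to hmaps]
        ring
    _ ≤ Fintype.card V * ∑ q ∈ P,
          (k + P.card + N) * (k + (F.filter fun e => own e = q).card) :=
        Nat.mul_le_mul_left _ (Finset.sum_le_sum fun q _ => hsmall q)
    _ = Fintype.card V * ((k + P.card + N) * (k * P.card + F.card)) := by
        rw [← Finset.mul_sum, Finset.sum_add_distrib, Finset.sum_const, smul_eq_mul,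
          ← Finset.card_eq_sum_card_fiberwise hmaps, mul_comm P.card]

end Counting

section Bounds

open Classical in
lemma minPresD_le_card_pathEdges {n : ℕ} {G G' : WDigraph (Fin n)} (hG : G.PosWeights)
    (hE : G'.Edge = G.Edge) (hG' : G'.PosWeights)
    (hsh : ∀ s t l, G'.IsWalk s t l → G'.walkWeight l = G'.dist s t →
      G.walkWeight l = G.dist s t)
    {P : Finset (Fin n × Fin n)} (hP : ∀ q ∈ P, G.Reachable q.1 q.2) :
    minPresD n G P ≤ (G'.pathEdges P).card := by
  have hsub : G'.pathEdges P ⊆ G'.Edge := by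
    rintro ⟨x, u⟩ he
    obtain ⟨q, -, -, hn⟩ := WDigraph.mem_pathEdges.1 he
    exact hn.1
  refine Nat.sInf_le ⟨G'.pathEdges P, ⟨hE ▸ hsub, fun q hq => ?_⟩, rfl⟩
  have hr : G'.Reachable q.1 q.2 := by
    have := hP q hq
    rwa [WDigraph.Reachable, ← hE] at this
  obtain ⟨l, hl, hlw⟩ := WDigraph.exists_walk_pathEdges hG' hq hr
  have hw := hsh _ _ l (hl.mono hsub) hlw
  have hpos : ∀ e ∈ G'.pathEdges P, 0 < G.w e := fun e he => hG e (hE ▸ hsub he)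
  refine ⟨⟨l, hl⟩, le_antisymm (hw ▸ G.distOn_le hpos hl) ?_⟩
  obtain ⟨k, hk, hkw⟩ := G.exists_walk_eq_distOn hpos ⟨l, hl⟩
  rw [← hkw]
  exact G.distOn_le hG (hk.mono (hE ▸ hsub))

lemma exists_preserver_le_of_UDP_le {lam mu C : ℝ} (hlam : 0 ≤ lam) (hmu : 0 ≤ mu) (hC : 0 ≤ C)
    (hUDP : ∀ n p : ℕ, 1 ≤ n → 1 ≤ p →
      (UDP n p : ℝ) ≤ C * ((n : ℝ) ^ lam * (p : ℝ) ^ mu + (n : ℝ)))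
    {m k p : ℕ} (hm : m ≤ k) {U : WGraph (Fin m)} (hU : U.PosWeights)
    {Q : Finset (Fin m × Fin m)} (hQp : Q.card ≤ p) (hQ : ∀ q ∈ Q, U.Reachable q.1 q.2) :
    ∃ F, U.IsExactPreserver F Q ∧
      F.card ≤ ⌊C * ((k : ℝ) ^ lam * (p : ℝ) ^ mu + (k : ℝ))⌋₊ := by
  rcases Q.eq_empty_or_nonempty with rfl | hne
  · exact ⟨∅, ⟨by simp, by simp⟩, by simp⟩
  obtain ⟨F, hF, hcard⟩ := WGraph.exists_preserver_le_UDP hU hQ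
  refine ⟨F, hF, Nat.le_floor ?_⟩
  obtain ⟨q, hq⟩ := hne
  have hm1 : 1 ≤ m := by
    have := q.1.2
    omega
  have hQ1 : 1 ≤ Q.card := Finset.card_pos.2 ⟨q, hq⟩
  refine ((Nat.cast_le.2 hcard).trans (hUDP m Q.card hm1 hQ1)).trans ?_
  gcongr

lemma le_of_mul_sq_le {lam mu C : ℝ} (hlam0 : 0 < lam) (hlam2 : lam < 2) (hC : 0 ≤ C)
    {E n p k N : ℝ} (hn : 1 ≤ n) (hp : 1 ≤ p) (hk : 0 < k) (hpE : p ≤ E)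
    (hEk : E ≤ k * p) (hkE : k * p ≤ 2 * E)
    (hN : N ≤ C * (k ^ lam * p ^ mu + k))
    (h : k * E ^ 2 ≤ n * ((k + p + N) * (k * p + E))) (hN0 : 0 ≤ N) :
    E ≤ (12 * (1 + C) + 3 + (6 * C * 2 ^ lam) ^ (1 / (2 - lam))) *
      (n ^ (1 / (2 - lam)) * p ^ ((1 + mu - lam) / (2 - lam)) + n ^ ((1 : ℝ) / 2) * p + n) := by
  have hn0 : 0 < n := by linarith
  have hp0 : 0 < p := by linarith
  have hE0 : 0 < E := by linarith
  have h2l : 0 < 2 - lam := by linarith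
  set T₁ := n ^ (1 / (2 - lam)) * p ^ ((1 + mu - lam) / (2 - lam)) with hT₁
  set T₂ := n ^ ((1 : ℝ) / 2) * p with hT₂
  set D := (6 * C * 2 ^ lam) ^ (1 / (2 - lam)) with hD
  have hT₁0 : 0 ≤ T₁ := by positivity
  have hT₂0 : 0 ≤ T₂ := by positivity
  have hD0 : 0 ≤ D := by positivity
  have hsq : E ^ 2 ≤ 2 * n * p * (k + p + N) := by
    have h1 : n * ((k + p + N) * (k * p + E)) ≤ n * ((k + p + N) * (2 * (k * p))) := by
      gcongr
      linarith
    refine le_of_mul_le_mul_left (a := k) ?_ hk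
    linarith
  have hpow : k ^ lam ≤ 2 ^ lam * E ^ lam * p ^ (-lam) := by
    have h1 : k ≤ 2 * E / p := (le_div_iff₀ hp0).2 hkE
    have h2 := Real.rpow_le_rpow hk.le h1 hlam0.le
    rwa [Real.div_rpow (by positivity) hp0.le, Real.mul_rpow (by norm_num) hE0.le,
      div_eq_mul_inv, ← Real.rpow_neg hp0.le] at h2
  have hX : 2 * n * p * (C * (k ^ lam * p ^ mu)) ≤
      2 * C * 2 ^ lam * (n * p ^ (1 + mu - lam)) * E ^ lam := by
    have h1 : p ^ (1 + mu - lam) = p * (p ^ (-lam) * p ^ mu) := by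
      rw [← Real.rpow_add hp0]
      nth_rewrite 2 [← Real.rpow_one p]
      rw [← Real.rpow_add hp0]
      ring_nf
    rw [h1]
    calc 2 * n * p * (C * (k ^ lam * p ^ mu))
        ≤ 2 * n * p * (C * ((2 ^ lam * E ^ lam * p ^ (-lam)) * p ^ mu)) := by gcongr
      _ = _ := by ring
  have hsum : E ^ 2 ≤ 4 * (1 + C) * n * E + 2 * n * p ^ 2 +
      2 * C * 2 ^ lam * (n * p ^ (1 + mu - lam)) * E ^ lam := by
    have h1 : 2 * n * p * (k + p + N) ≤
        2 * n * p * (k + p + C * (k ^ lam * p ^ mu + k)) := by gcongr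
    have h2 : 2 * (1 + C) * n * (k * p) ≤ 2 * (1 + C) * n * (2 * E) := by gcongr
    linarith
  by_cases hcase1 : E ≤ 12 * (1 + C) * n
  · have : 0 ≤ (12 * (1 + C)) * (T₁ + T₂) := by positivity
    have : 0 ≤ (3 + D) * (T₁ + T₂ + n) := by positivity
    linarith
  by_cases hcase2 : E ≤ 3 * T₂
  · have : 0 ≤ (12 * (1 + C) + D) * (T₁ + T₂ + n) := by positivity
    linarith
  have hE1 : 4 * (1 + C) * n * E ≤ E ^ 2 / 3 := by nlinarith
  have hE2 : 2 * n * p ^ 2 ≤ E ^ 2 / 3 := by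
    have h1 : T₂ ^ 2 = n * p ^ 2 := by
      rw [hT₂, mul_pow, ← Real.sqrt_eq_rpow, Real.sq_sqrt hn0.le]
    have h2 : (3 * T₂) ^ 2 ≤ E ^ 2 := by gcongr; linarith
    have h3 : 0 ≤ n * p ^ 2 := by positivity
    linarith
  have hE3 : E ^ 2 ≤ 6 * C * 2 ^ lam * (n * p ^ (1 + mu - lam)) * E ^ lam := by linarith
  have hE4 : E ^ (2 - lam) ≤ 6 * C * 2 ^ lam * (n * p ^ (1 + mu - lam)) := by
    rw [Real.rpow_sub hE0, div_le_iff₀ (by positivity), Real.rpow_two]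
    exact hE3
  have hE5 : E ≤ D * T₁ := by
    have h1 := Real.rpow_le_rpow (by positivity) hE4 (by positivity : 0 ≤ 1 / (2 - lam))
    rwa [← Real.rpow_mul hE0.le, mul_one_div_cancel h2l.ne', Real.rpow_one,
      Real.mul_rpow (by positivity) (by positivity), Real.mul_rpow hn0.le (by positivity),
      ← Real.rpow_mul hp0.le, mul_one_div] at h1
  have : 0 ≤ D * (T₂ + n) := by positivity
  have : 0 ≤ (12 * (1 + C) + 3) * (T₁ + T₂ + n) := by positivity
  linarith

end Bounds

/-- the directed-to-undirected reduction for exact distance preservers. -/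
theorem directed_preserver_from_undirected (lam mu : ℝ)
    (hlam0 : 0 < lam) (hlam2 : lam < 2) (hmu : 0 < mu) (C : ℝ)
    (hUDP : ∀ n p : ℕ, 1 ≤ n → 1 ≤ p →
      (UDP n p : ℝ) ≤ C * ((n : ℝ) ^ lam * (p : ℝ) ^ mu + (n : ℝ))) :
    ∃ C' : ℝ, ∀ n p : ℕ, 1 ≤ n → 1 ≤ p →
      (DDP n p : ℝ) ≤ C' * ((n : ℝ) ^ ((1 : ℝ) / (2 - lam)) *
          (p : ℝ) ^ ((1 + mu - lam) / (2 - lam)) +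
        (n : ℝ) ^ ((1 : ℝ) / 2) * (p : ℝ) + (n : ℝ)) := by
  set C₀ := max C 0
  have hC₀ : 0 ≤ C₀ := le_max_right _ _
  have hUDP₀ : ∀ n p : ℕ, 1 ≤ n → 1 ≤ p →
      (UDP n p : ℝ) ≤ C₀ * ((n : ℝ) ^ lam * (p : ℝ) ^ mu + (n : ℝ)) := fun n p hn hp =>
    (hUDP n p hn hp).trans (mul_le_mul_of_nonneg_right (le_max_left _ _) (by positivity))
  refine ⟨12 * (1 + C₀) + 3 + (6 * C₀ * 2 ^ lam) ^ (1 / (2 - lam)), fun n p hn hp => ?_⟩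
  have hn' : (1 : ℝ) ≤ n := by exact_mod_cast hn
  have hp' : (1 : ℝ) ≤ p := by exact_mod_cast hp
  have hD : 0 ≤ (6 * C₀ * 2 ^ lam) ^ (1 / (2 - lam)) := by positivity
  have hT : 0 ≤ (n : ℝ) ^ ((1 : ℝ) / (2 - lam)) * (p : ℝ) ^ ((1 + mu - lam) / (2 - lam)) := by
    positivity
  refine (Nat.cast_le.2 (csSup_le' ?_)).trans (Nat.floor_le (by positivity))
  rintro _ ⟨G, hG, P, rfl, hP, rfl⟩
  refine Nat.le_floor ?_
  obtain ⟨G', hE, hG', hU, hsh⟩ := WDigraph.exists_perturbation hG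
  refine (Nat.cast_le.2 (minPresD_le_card_pathEdges hG hE hG' hsh hP)).trans ?_
  set m := (G'.pathEdges P).card with hm
  have hp0 : (0 : ℝ) < P.card := by linarith
  rcases lt_or_ge (m : ℝ) P.card with hlt | hge
  · have h1 : (P.card : ℝ) ≤ (n : ℝ) ^ ((1 : ℝ) / 2) * P.card :=
      le_mul_of_one_le_left hp0.le (Real.one_le_rpow hn' (by norm_num))
    have h2 : (0 : ℝ) ≤ (n : ℝ) ^ ((1 : ℝ) / 2) * P.card := by positivity
    refine (hlt.le.trans h1).trans (le_trans ?_ (le_mul_of_one_le_left ?_ ?_)) <;> linarith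
  · set k := ⌈(m : ℝ) / P.card⌉₊
    have hmk : (m : ℝ) / P.card ≤ k := Nat.le_ceil _
    have hone : 1 ≤ (m : ℝ) / P.card := (one_le_div hp0).2 hge
    have hk : (k : ℝ) ≤ 2 * m / P.card := by
      have := (Nat.ceil_lt_add_one (by positivity : 0 ≤ (m : ℝ) / P.card)).le
      rw [mul_div_assoc]
      linarith
    have hcount := WDigraph.mul_card_pathEdges_sq_le hG' hU P (k := k)
      fun _ hjk _ hpos _ hQ hr =>
        exists_preserver_le_of_UDP_le hlam0.le hmu.le hC₀ hUDP₀ hjk hpos hQ hr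
    rw [Fintype.card_fin] at hcount
    exact le_of_mul_sq_le hlam0 hlam2 hC₀ hn' hp' (by linarith) hge ((div_le_iff₀ hp0).1 hmk)
      ((le_div_iff₀ hp0).1 hk) (Nat.floor_le (by positivity)) (by exact_mod_cast hcount)
      (by positivity)
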